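/- arXiv:0902.2300 — 4 statements merged into one kernel-verified Lean document; each statement's English description precedes it below -/
import Mathlib

section
/- For every natural number n and every n×n matrix A over a commutative ring R, the independent set polynomial of the graph G'_n with vertex weights w(i,j) = A i j equals the partial permanent PER*(A). (Independent sets of G'_n are exactly the partial matchings of the complete bipartite graph K_{n,n}.) -/
attribute [local instance] Classical.propDecidable

/-- The partial permanent of an `n × n` matrix: the sum, over all injective partial maps
`π` from `Fin n` to `Fin n`, of the products `∏_{i ∈ dom π} A i (π i)`. -/
noncomputable def partialPerm {n : ℕ} {R : Type*} [CommRing R]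
    (A : Matrix (Fin n) (Fin n) R) : R :=
  ∑ f ∈ Finset.univ.filter
      (fun f : Fin n → Option (Fin n) => ∀ i j k, f i = some k → f j = some k → i = j),
    ∏ i, (f i).elim 1 (fun j => A i j)

/-- The independent set polynomial of a vertex-weighted finite graph. -/
noncomputable def indepPoly {V : Type*} [Fintype V] {R : Type*} [CommRing R]
    (G : SimpleGraph V) (w : V → R) : R :=
  ∑ S ∈ Finset.univ.filter (fun S : Finset V => ∀ a ∈ S, ∀ b ∈ S, ¬ G.Adj a b),
    ∏ v ∈ S, w v

/-- The graph `G'_n` on vertex set `Fin n × Fin n`, two distinct vertices being adjacent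
iff they share a coordinate. -/
def Gn (n : ℕ) : SimpleGraph (Fin n × Fin n) :=
  SimpleGraph.fromRel (fun p q => p.1 = q.1 ∨ p.2 = q.2)

/-- The graph of a partial map, as a finite set of pairs. -/
noncomputable def partialGraph {α β : Type*} [Fintype α] [Fintype β] (f : α → Option β) :
    Finset (α × β) :=
  Finset.univ.filter fun p => f p.1 = some p.2

theorem mem_partialGraph {α β : Type*} [Fintype α] [Fintype β] {f : α → Option β} {p : α × β} :
    p ∈ partialGraph f ↔ f p.1 = some p.2 := by
  simp [partialGraph]

theorem partialGraph_injective {α β : Type*} [Fintype α] [Fintype β] :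
    Function.Injective (partialGraph : (α → Option β) → Finset (α × β)) := by
  intro f g h
  funext i
  refine Option.ext fun j => ?_
  simpa only [mem_partialGraph] using Finset.ext_iff.mp h (i, j)

theorem exists_partialGraph_eq {α β : Type*} [Fintype α] [Fintype β] (S : Finset (α × β))
    (hS : ∀ i j k, (i, j) ∈ S → (i, k) ∈ S → j = k) :
    ∃ f : α → Option β, partialGraph f = S := by
  have h : ∀ i, ∃ o : Option β, ∀ j, o = some j ↔ (i, j) ∈ S := by
    intro i
    by_cases hi : ∃ j, (i, j) ∈ S
    · obtain ⟨j, hj⟩ := hi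
      refine ⟨some j, fun k => ⟨?_, fun hk => congrArg some (hS i j k hj hk)⟩⟩
      rintro ⟨⟩
      exact hj
    · push Not at hi
      exact ⟨none, fun j => by simp [hi j]⟩
  choose f hf using h
  exact ⟨f, Finset.ext fun p => mem_partialGraph.trans (hf p.1 p.2)⟩

theorem prod_partialGraph {α β M : Type*} [Fintype α] [Fintype β] [CommMonoid M]
    (f : α → Option β) (w : α → β → M) :
    ∏ p ∈ partialGraph f, w p.1 p.2 = ∏ i, (f i).elim 1 (w i) := by
  rw [partialGraph, Finset.prod_filter, Fintype.prod_prod_type]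
  refine Finset.prod_congr rfl fun i _ => ?_
  cases h : f i <;> simp [h]

theorem Gn_independent_iff {n : ℕ} (S : Finset (Fin n × Fin n)) :
    (∀ a ∈ S, ∀ b ∈ S, ¬ (Gn n).Adj a b) ↔
      (∀ i j k, (i, j) ∈ S → (i, k) ∈ S → j = k) ∧
        ∀ i j k, (i, k) ∈ S → (j, k) ∈ S → i = j := by
  simp only [Gn, SimpleGraph.fromRel_adj, Prod.forall, ne_eq, Prod.mk.injEq]
  grind

theorem stmt1 {n : ℕ} {R : Type*} [CommRing R] (A : Matrix (Fin n) (Fin n) R) :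
    indepPoly (Gn n) (fun p => A p.1 p.2) = partialPerm A := by
  rw [indepPoly, partialPerm, eq_comm]
  refine Finset.sum_bij (fun f _ => partialGraph f) ?_ (fun _ _ _ _ h => partialGraph_injective h)
    ?_ fun f _ => (prod_partialGraph f A).symm
  · intro f hf
    simp only [Finset.mem_filter_univ, Gn_independent_iff, mem_partialGraph] at hf ⊢
    exact ⟨fun i j k hj hk => Option.some.inj (hj.symm.trans hk), hf⟩
  · intro S hS
    simp only [Finset.mem_filter_univ, Gn_independent_iff] at hS
    obtain ⟨f, rfl⟩ := exists_partialGraph_eq S hS.1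
    refine ⟨f, ?_, rfl⟩
    simpa only [Finset.mem_filter_univ, mem_partialGraph] using hS.2
end

section
/- Let G' be a finite simple graph with vertex set V', edge set E', and vertex weights w : V' → R over a commutative ring R, and let G be its incidence graph with the extended weight function ŵ (equal to w on V'-vertices and to −1 on E'-vertices). Then VCP(G, ŵ) = (−1)^{|E'|} · IP(G', w). -/
attribute [local instance] Classical.propDecidable

/-- The vertex cover polynomial of a vertex-weighted finite graph. -/
noncomputable def vcPoly {V : Type*} [Fintype V] {R : Type*} [CommRing R]
    (G : SimpleGraph V) (w : V → R) : R :=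
  ∑ C ∈ Finset.univ.filter (fun C : Finset V => ∀ a b, G.Adj a b → a ∈ C ∨ b ∈ C),
    ∏ v ∈ C, w v

/-- The incidence graph of a simple graph `G`: the bipartite graph on `V ⊕ G.edgeSet`
in which an edge-vertex `e` is adjacent to a vertex `v` iff `v` is an endpoint of `e`. -/
def incidenceGraph {V : Type*} (G : SimpleGraph V) :
    SimpleGraph (V ⊕ ↥G.edgeSet) :=
  SimpleGraph.fromRel (fun a b =>
    match a, b with
    | Sum.inl v, Sum.inr e => v ∈ (e : Sym2 V)
    | _, _ => False)

theorem incidenceGraph_cover_iff {V : Type*} (G : SimpleGraph V)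
    (A : Finset V) (B : Finset ↥G.edgeSet) :
    (∀ a b, (incidenceGraph G).Adj a b → a ∈ A.disjSum B ∨ b ∈ A.disjSum B) ↔
      ∀ e ∉ B, ∀ v ∈ (e : Sym2 V), v ∈ A := by
  constructor
  · intro h e he v hv
    have hadj : (incidenceGraph G).Adj (Sum.inl v) (Sum.inr e) := by
      simp [incidenceGraph, hv]
    simpa [he] using h _ _ hadj
  · rintro h (a | e) (b | f) hadj <;> simp [incidenceGraph] at hadj ⊢
    · by_contra! hc
      exact hc.1 (h f hc.2 a hadj)
    · by_contra! hc
      exact hc.2 (h e hc.1 b hadj)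

/-- A signed sum over all finsets whose complement satisfies `p` pointwise. -/
theorem sum_neg_one_pow_card_of_compl {E : Type*} [Fintype E] {R : Type*} [CommRing R]
    (p : E → Prop) :
    (∑ B : Finset E, if ∀ e ∉ B, p e then (∏ _e ∈ B, (-1 : R)) else 0) =
      if ∀ e, ¬ p e then (-1) ^ Fintype.card E else 0 := by
  have key : (∏ e : E, ((-1 : R) + if p e then 1 else 0)) =
      ∑ B : Finset E, if ∀ e ∉ B, p e then (∏ _e ∈ B, (-1 : R)) else 0 := by
    rw [Finset.prod_add, Finset.powerset_univ]
    refine Finset.sum_congr rfl fun B _ => ?_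
    rw [Finset.prod_ite_zero]
    simp
  rw [← key]
  split_ifs with h
  · simp [h]
  · push Not at h
    obtain ⟨e, he⟩ := h
    exact Finset.prod_eq_zero (Finset.mem_univ e) (by simp [he])

theorem indep_iff_forall_edge {V : Type*} (G : SimpleGraph V) (A : Finset V) :
    (∀ a ∈ A, ∀ b ∈ A, ¬ G.Adj a b) ↔
      ∀ e : ↥G.edgeSet, ¬ ∀ v ∈ (e : Sym2 V), v ∈ A := by
  constructor
  · rintro h ⟨e, he⟩ hA
    induction e with
    | _ a b => exact h a (hA a (by simp)) b (hA b (by simp)) he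
  · intro h a ha b hb hab
    refine h ⟨s(a, b), hab⟩ fun v hv => ?_
    rcases Sym2.mem_iff.1 hv with rfl | rfl <;> assumption

theorem stmt3 {V : Type*} [Fintype V] {R : Type*} [CommRing R]
    (G : SimpleGraph V) (w : V → R) :
    vcPoly (incidenceGraph G) (Sum.elim w (fun _ => -1))
      = (-1) ^ (Fintype.card ↥G.edgeSet) * indepPoly G w := by
  unfold vcPoly indepPoly
  rw [Finset.sum_filter, Finset.sum_filter, Finset.mul_sum,
    ← Equiv.sum_comp (Finset.sumEquiv (α := V) (β := ↥G.edgeSet)).symm.toEquiv,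
    Fintype.sum_prod_type]
  refine Finset.sum_congr rfl fun A _ => ?_
  have h := sum_neg_one_pow_card_of_compl (R := R)
    (fun e : ↥G.edgeSet => ∀ v ∈ (e : Sym2 V), v ∈ A)
  simp only [← indep_iff_forall_edge] at h
  trans (∏ v ∈ A, w v) *
    if ∀ a ∈ A, ∀ b ∈ A, ¬ G.Adj a b then (-1) ^ Fintype.card ↥G.edgeSet else 0
  · rw [← h, Finset.mul_sum]
    refine Finset.sum_congr rfl fun B _ => ?_
    have hs : (Finset.sumEquiv (α := V) (β := ↥G.edgeSet)).symm.toEquiv (A, B) =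
        A.disjSum B := rfl
    rw [hs, Finset.prod_disjSum]
    simp only [incidenceGraph_cover_iff, Sum.elim_inl, Sum.elim_inr, mul_ite, mul_zero]
  · split_ifs <;> ring
end

section
/- Let G be a finite simple graph with edge set E and vertex weights w over a commutative ring R, and let G'' be the incidence graph of the incidence graph of G, each application of the incidence-graph construction assigning weight −1 to the newly added vertices. Then G'' is bipartite and IP(G'', ŵ) = (−1)^{|E|} · IP(G, w). -/
attribute [local instance] Classical.propDecidable

section incidenceGraph

variable {V : Type*} {G : SimpleGraph V}

@[simp]
theorem incidenceGraph_adj_inl_inr {v : V} {e : G.edgeSet} :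
    (incidenceGraph G).Adj (Sum.inl v) (Sum.inr e) ↔ v ∈ (e : Sym2 V) := by
  simp [incidenceGraph]

@[simp]
theorem incidenceGraph_adj_inr_inl {v : V} {e : G.edgeSet} :
    (incidenceGraph G).Adj (Sum.inr e) (Sum.inl v) ↔ v ∈ (e : Sym2 V) := by
  simp [incidenceGraph]

@[simp]
theorem incidenceGraph_not_adj_inl_inl {v v' : V} :
    ¬ (incidenceGraph G).Adj (Sum.inl v) (Sum.inl v') := by
  simp [incidenceGraph]

@[simp]
theorem incidenceGraph_not_adj_inr_inr {e e' : G.edgeSet} :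
    ¬ (incidenceGraph G).Adj (Sum.inr e) (Sum.inr e') := by
  simp [incidenceGraph]

theorem incidenceGraph_colorable_two (G : SimpleGraph V) : (incidenceGraph G).Colorable 2 :=
  ⟨SimpleGraph.Coloring.mk (Sum.elim (fun _ => 0) (fun _ => 1)) (by
    rintro (a | a) (b | b) h <;> simp_all)⟩

end incidenceGraph

section

variable {R : Type*} [CommRing R]

theorem sum_filter_finset_sum_prod {α β : Type*} [Fintype α] [Fintype β]
    (P : Finset (α ⊕ β) → Prop) [DecidablePred P] (f : α ⊕ β → R) :
    ∑ S ∈ Finset.univ.filter P, ∏ x ∈ S, f x =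
      ∑ X : Finset α, (∏ a ∈ X, f (Sum.inl a)) *
        ∑ Y ∈ Finset.univ.filter (fun Y : Finset β => P (X.disjSum Y)), ∏ b ∈ Y, f (Sum.inr b) := by
  simp only [Finset.sum_filter, Finset.mul_sum, mul_ite, mul_zero, ← Finset.prod_disjSum]
  rw [← Fintype.sum_prod_type']
  exact Fintype.sum_equiv Finset.sumEquiv.toEquiv _ _ fun S => by
    simp [Finset.sumEquiv, Finset.toLeft_disjSum_toRight]

theorem sum_filter_subset_neg_one {β : Type*} [Fintype β] (N : Finset β)
    [DecidablePred fun Y : Finset β => Y ⊆ N] :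
    ∑ Y ∈ Finset.univ.filter (fun Y : Finset β => Y ⊆ N), ∏ _b ∈ Y, (-1 : R) =
      if N = ∅ then 1 else 0 := by
  have h : Finset.univ.filter (fun Y : Finset β => Y ⊆ N) = N.powerset := by ext; simp
  have := Finset.sum_powerset_neg_one_pow_card (x := N)
  rw [h]
  simpa using congrArg (Int.cast : ℤ → R) this

theorem sum_filter_superset_neg_one {β : Type*} [Fintype β] (N : Finset β)
    [DecidablePred fun Y : Finset β => N ⊆ Y] :
    ∑ Y ∈ Finset.univ.filter (fun Y : Finset β => N ⊆ Y), ∏ _b ∈ Y, (-1 : R) =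
      if N = Finset.univ then (-1) ^ Fintype.card β else 0 := by
  have h := sum_filter_subset_neg_one (R := R) Nᶜ
  simp only [Finset.compl_eq_empty_iff] at h
  rw [← mul_one ((-1 : R) ^ Fintype.card β), ← mul_zero ((-1 : R) ^ Fintype.card β), ← mul_ite,
    ← h, Finset.mul_sum]
  refine Finset.sum_nbij' (fun Y => Yᶜ) (fun Y => Yᶜ) ?_ ?_ ?_ ?_ ?_
  · simp
  · intro Y hY
    simpa [Finset.subset_compl_comm] using hY
  · simp
  · simp
  · intro Y _
    rw [← Finset.card_add_card_compl Y, pow_add, mul_assoc]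
    simp [← mul_pow]

variable {V : Type*} [Fintype V] (G : SimpleGraph V) (w : V → R)

theorem indepPoly_incidenceGraph :
    indepPoly (incidenceGraph G) (Sum.elim w fun _ => -1) = vcPoly G w := by
  rw [indepPoly, sum_filter_finset_sum_prod, vcPoly, Finset.sum_filter]
  refine Finset.sum_congr rfl fun X _ => ?_
  simp only [Sum.elim_inl, Sum.elim_inr]
  let N : Finset G.edgeSet := Finset.univ.filter fun e => ∀ v ∈ X, v ∉ (e : Sym2 V)
  have hN (Y : Finset G.edgeSet) : (∀ a ∈ X.disjSum Y, ∀ b ∈ X.disjSum Y,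
      ¬ (incidenceGraph G).Adj a b) ↔ Y ⊆ N := by
    simp only [Finset.subset_iff, N, Finset.mem_filter, Finset.mem_univ, true_and, Sum.forall,
      Finset.inl_mem_disjSum, Finset.inr_mem_disjSum, incidenceGraph_adj_inl_inr,
      incidenceGraph_adj_inr_inl, incidenceGraph_not_adj_inl_inl, incidenceGraph_not_adj_inr_inr]
    grind
  have hcover : N = ∅ ↔ ∀ a b, G.Adj a b → a ∈ X ∨ b ∈ X := by
    simp only [N, Finset.filter_eq_empty_iff, Finset.mem_univ, true_imp_iff, Subtype.forall,
      Sym2.forall, SimpleGraph.mem_edgeSet, Sym2.mem_iff]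
    grind
  simp only [hN, sum_filter_subset_neg_one, hcover, mul_ite, mul_one, mul_zero]

theorem vcPoly_incidenceGraph :
    vcPoly (incidenceGraph G) (Sum.elim w fun _ => -1) =
      (-1) ^ Fintype.card G.edgeSet * indepPoly G w := by
  rw [vcPoly, sum_filter_finset_sum_prod, indepPoly, Finset.sum_filter, Finset.mul_sum]
  refine Finset.sum_congr rfl fun X _ => ?_
  simp only [Sum.elim_inl, Sum.elim_inr]
  let N : Finset G.edgeSet := Finset.univ.filter fun e => ∃ v ∈ (e : Sym2 V), v ∉ X
  have hN (Y : Finset G.edgeSet) : (∀ a b, (incidenceGraph G).Adj a b →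
      a ∈ X.disjSum Y ∨ b ∈ X.disjSum Y) ↔ N ⊆ Y := by
    simp only [Finset.subset_iff, N, Finset.mem_filter, Finset.mem_univ, true_and, Sum.forall,
      Finset.inl_mem_disjSum, Finset.inr_mem_disjSum, incidenceGraph_adj_inl_inr,
      incidenceGraph_adj_inr_inl, incidenceGraph_not_adj_inl_inl, incidenceGraph_not_adj_inr_inr]
    grind
  have hindep : N = Finset.univ ↔ ∀ a ∈ X, ∀ b ∈ X, ¬ G.Adj a b := by
    simp only [N, Finset.filter_eq_self, Finset.mem_univ, true_imp_iff, Subtype.forall,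
      Sym2.forall, SimpleGraph.mem_edgeSet, Sym2.mem_iff]
    grind
  rw [mul_comm]
  simp only [hN, sum_filter_superset_neg_one, hindep, ite_mul, mul_ite, mul_zero, zero_mul]

end

theorem stmt5 {V : Type*} [Fintype V] {R : Type*} [CommRing R]
    (G : SimpleGraph V) (w : V → R) :
    (incidenceGraph (incidenceGraph G)).Colorable 2 ∧
    indepPoly (incidenceGraph (incidenceGraph G))
        (Sum.elim (Sum.elim w (fun _ => -1)) (fun _ => -1))
      = (-1) ^ (Fintype.card ↥G.edgeSet) * indepPoly G w := by
  exact ⟨incidenceGraph_colorable_two _,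
    (indepPoly_incidenceGraph _ _).trans (vcPoly_incidenceGraph G w)⟩
end

section
/- Let V1 and V2 be finite sets and r a relation with r x y only for x ∈ V1 and y ∈ V2, and let ≤ be the partial order on the disjoint union V1 ⊕ V2 defined by u ≤ v iff u = v, or u ∈ V1, v ∈ V2 and r u v. Then the map sending a set A ⊆ V1 ⊕ V2 to (A ∩ V2) ∪ (V1 \ A) is a bijection from the antichains of this poset to its lower sets. -/
/-- The partial order on `V1 ⊕ V2` in which `u ≤ v` iff `u = v`, or `u ∈ V1`, `v ∈ V2`
and `r u v`. -/
def sumOrder {V1 V2 : Type*} (r : V1 → V2 → Prop) : PartialOrder (V1 ⊕ V2) where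
  le a b := a = b ∨ ∃ x y, a = Sum.inl x ∧ b = Sum.inr y ∧ r x y
  le_refl a := Or.inl rfl
  le_trans a b c hab hbc := by
    rcases hab with rfl | ⟨x, y, rfl, rfl, hxy⟩
    · exact hbc
    · rcases hbc with h | ⟨x', y', h, _, _⟩
      · exact Or.inr ⟨x, y, rfl, h.symm, hxy⟩
      · simp at h
  le_antisymm a b hab hba := by
    rcases hab with rfl | ⟨x, y, rfl, rfl, hxy⟩
    · rfl
    · rcases hba with h | ⟨x', y', h, _, _⟩
      · exact h.symm
      · simp at h

theorem isAntichain_sumOrder_iff {V1 V2 : Type*} (r : V1 → V2 → Prop) (A : Set (V1 ⊕ V2)) :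
    IsAntichain (sumOrder r).le A ↔ ∀ x y, r x y → Sum.inr y ∈ A → Sum.inl x ∉ A := by
  constructor
  · intro h x y hxy hy hx
    exact h hx hy (by simp) (Or.inr ⟨x, y, rfl, rfl, hxy⟩)
  · rintro h a ha b hb hab (rfl | ⟨x, y, rfl, rfl, hxy⟩)
    · exact hab rfl
    · exact h x y hxy hb ha

theorem isLowerSet_sumOrder_iff {V1 V2 : Type*} (r : V1 → V2 → Prop) (I : Set (V1 ⊕ V2)) :
    @IsLowerSet _ (sumOrder r).toLE I ↔ ∀ x y, r x y → Sum.inr y ∈ I → Sum.inl x ∈ I := by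
  constructor
  · intro h x y hxy hy
    exact h (Or.inr ⟨x, y, rfl, rfl, hxy⟩) hy
  · rintro h b a (rfl | ⟨x, y, rfl, rfl, hxy⟩) hb
    · exact hb
    · exact h x y hxy hb

theorem stmt9 {V1 V2 : Type*} [Fintype V1] [Fintype V2] (r : V1 → V2 → Prop) :
    letI : PartialOrder (V1 ⊕ V2) := sumOrder r
    Set.BijOn
      (fun A : Set (V1 ⊕ V2) =>
        {z : V1 ⊕ V2 | Sum.elim (fun x => Sum.inl x ∉ A) (fun y => Sum.inr y ∈ A) z})
      {A : Set (V1 ⊕ V2) | IsAntichain (· ≤ ·) A}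
      {I : Set (V1 ⊕ V2) | IsLowerSet I} := by
  refine Set.InvOn.bijOn (f' := fun A : Set (V1 ⊕ V2) =>
    {z : V1 ⊕ V2 | Sum.elim (fun x => Sum.inl x ∉ A) (fun y => Sum.inr y ∈ A) z})
    ⟨?_, ?_⟩ ?_ ?_
  · rintro A -
    ext (x | y) <;> simp
  · rintro I -
    ext (x | y) <;> simp
  · intro A hA
    exact (isLowerSet_sumOrder_iff r _).2 ((isAntichain_sumOrder_iff r A).1 hA)
  · intro I hI
    refine (isAntichain_sumOrder_iff r _).2 fun x y hxy hy hx => ?_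
    exact hx ((isLowerSet_sumOrder_iff r I).1 hI x y hxy hy)
end
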